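/- arXiv:1903.06119 — 3 statements merged into one kernel-verified Lean document; each statement's English description precedes it below -/
import Mathlib

section
/- Let r be a nonzero real with |r| < 2^emax·(2 − 2^(−p)), so that x := [r]n is an element of 𝔽. Then ∇2n−(x)/2 ≤ r − x ≤ ∇2n+(x)/2, and both inequalities are strict whenever x is odd. -/
noncomputable section

open scoped Classical

namespace FPVerif

/-- The set of finite IEEE 754 binary floating-point numbers with
precision `p` and maximum exponent `emax` (minimum exponent `1 - emax`),
viewed as a set of real numbers. -/
def F (p emax : ℤ) : Set ℝ :=
  {x | ∃ (s : ℝ) (e M : ℤ), (s = 1 ∨ s = -1) ∧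
    1 - emax ≤ e ∧ e ≤ emax ∧ (0 : ℝ) ≤ (M : ℝ) ∧ (M : ℝ) ≤ (2 : ℝ) ^ p - 1 ∧
    x = s * (M : ℝ) * (2 : ℝ) ^ (e + 1 - p)}

/-- The smallest positive float. -/
def fmin (p emax : ℤ) : ℝ := (2 : ℝ) ^ ((1 - emax) + 1 - p)

/-- The largest float. -/
def fmax (p emax : ℤ) : ℝ := (2 : ℝ) ^ emax * (2 - (2 : ℝ) ^ (1 - p))

/-- The successor of `x` in `F p emax` (meaningful when `x ∈ F` and `x < fmax`). -/
def fsucc (p emax : ℤ) (x : ℝ) : ℝ := sInf {y | y ∈ F p emax ∧ x < y}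

/-- The predecessor of `x` in `F p emax` (meaningful when `x ∈ F` and `-fmax < x`). -/
def fpred (p emax : ℤ) (x : ℝ) : ℝ := sSup {y | y ∈ F p emax ∧ y < x}

/-- Round toward minus infinity, valued in the extended reals. -/
def rndDown (p emax : ℤ) (x : ℝ) : EReal :=
  if x < -fmax p emax then ⊥
  else ((sSup {z | z ∈ F p emax ∧ z ≤ x} : ℝ) : EReal)

/-- Round toward plus infinity, valued in the extended reals. -/
def rndUp (p emax : ℤ) (x : ℝ) : EReal :=
  if fmax p emax < x then ⊤
  else ((sInf {z | z ∈ F p emax ∧ x ≤ z} : ℝ) : EReal)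

/-- Round toward zero, valued in the extended reals. -/
def rndZero (p emax : ℤ) (x : ℝ) : EReal :=
  if 0 < x then rndDown p emax x else rndUp p emax x

/-- A float `z` is even if it is zero or its mantissa digit string ends in 0,
i.e. `z / 2 ^ (e_z + 1 - p)` is an even integer, where
`e_z = max (1 - emax) ⌊log₂ |z|⌋`. -/
def FEven (p emax : ℤ) (z : ℝ) : Prop :=
  z = 0 ∨ ∃ k : ℤ, Even k ∧
    z = (k : ℝ) * (2 : ℝ) ^ (max (1 - emax) (Int.log 2 |z|) + 1 - p)

/-- The set of floats at minimal distance from `x`. -/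
def nearestSet (p emax : ℤ) (x : ℝ) : Set ℝ :=
  {z | z ∈ F p emax ∧ ∀ w ∈ F p emax, |x - z| ≤ |x - w|}

/-- The float at minimal distance from `x`, a tie being broken by
choosing the even one. -/
def nearest (p emax : ℤ) (x : ℝ) : ℝ :=
  if h : ∃ z, z ∈ nearestSet p emax x ∧ FEven p emax z then h.choose
  else if h2 : ∃ z, z ∈ nearestSet p emax x then h2.choose
  else 0

/-- Round to nearest (ties to even), valued in the extended reals. -/
def rndNear (p emax : ℤ) (x : ℝ) : EReal :=
  if (2 : ℝ) ^ emax * (2 - (2 : ℝ) ^ (-p)) ≤ x then ⊤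
  else if x ≤ -((2 : ℝ) ^ emax * (2 - (2 : ℝ) ^ (-p))) then ⊥
  else ((nearest p emax x : ℝ) : EReal)

/-- Twice the downward round-to-nearest error bound `∇2n−`. -/
def nablaNm (p emax : ℤ) (x : ℝ) : ℝ :=
  if x = -fmax p emax then x - fsucc p emax x else fpred p emax x - x

/-- Twice the upward round-to-nearest error bound `∇2n+`. -/
def nablaNp (p emax : ℤ) (x : ℝ) : ℝ :=
  if x = fmax p emax then x - fpred p emax x else fsucc p emax x - x

end FPVerif

namespace FPVerif

lemma mem_F_of (p emax e k : ℤ) (hp : 2 ≤ p) (h1 : 1 - emax ≤ e) (h2 : e ≤ emax)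
    (hk : |(k : ℝ)| < (2 : ℝ) ^ p) : (k : ℝ) * (2 : ℝ) ^ (e + 1 - p) ∈ F p emax := by
  have hk' : |(k : ℝ)| ≤ (2 : ℝ) ^ p - 1 := by
    obtain ⟨n, rfl⟩ : ∃ n : ℕ, p = n := ⟨p.toNat, by omega⟩
    have : |k| < (2 : ℤ) ^ n := by
      have h : ((|k| : ℤ) : ℝ) < (((2 : ℤ) ^ n : ℤ) : ℝ) := by
        push_cast
        simpa using hk
      exact_mod_cast h
    have h3 : |k| ≤ (2 : ℤ) ^ n - 1 := by omega
    have h4 : ((|k| : ℤ) : ℝ) ≤ (((2 : ℤ) ^ n - 1 : ℤ) : ℝ) := by exact_mod_cast h3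
    push_cast at h4
    simpa using h4
  rcases le_total 0 k with h | h
  · have h0 : (0 : ℝ) ≤ k := by exact_mod_cast h
    refine ⟨1, e, k, Or.inl rfl, h1, h2, h0, ?_, by ring⟩
    rwa [abs_of_nonneg h0] at hk'
  · have h0 : (k : ℝ) ≤ 0 := by exact_mod_cast h
    refine ⟨-1, e, -k, Or.inr rfl, h1, h2, ?_, ?_, ?_⟩
    · push_cast; linarith
    · rw [abs_of_nonpos h0] at hk'
      push_cast; exact hk'
    · push_cast; ring

lemma F_neg {p emax : ℤ} {x : ℝ} (h : x ∈ F p emax) : -x ∈ F p emax := by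
  obtain ⟨s, e, M, hs, h1, h2, h3, h4, rfl⟩ := h
  refine ⟨-s, e, M, ?_, h1, h2, h3, h4, by ring⟩
  rcases hs with rfl | rfl
  · right; rfl
  · left; norm_num

lemma F_finite (p emax : ℤ) : (F p emax).Finite := by
  have hf : ((({1, -1} : Set ℝ) ×ˢ ((Set.Icc (1 - emax) emax) ×ˢ
      (Set.Icc (0 : ℤ) ⌊(2 : ℝ) ^ p - 1⌋)))).Finite := by
    apply Set.Finite.prod
    · simp
    · exact (Set.finite_Icc _ _).prod (Set.finite_Icc _ _)
  refine (hf.image (fun t : ℝ × ℤ × ℤ => t.1 * (t.2.2 : ℝ) * (2 : ℝ) ^ (t.2.1 + 1 - p))).subset ?_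
  rintro x ⟨s, e, M, hs, h1, h2, h3, h4, rfl⟩
  refine ⟨(s, e, M), ?_, rfl⟩
  refine ⟨?_, ⟨h1, h2⟩, ?_, ?_⟩
  · rcases hs with rfl | rfl <;> simp
  · exact_mod_cast h3
  · exact Int.le_floor.2 h4

lemma F_zero (p emax : ℤ) (hp : 2 ≤ p) (he : 1 ≤ emax) : (0 : ℝ) ∈ F p emax := by
  have := mem_F_of p emax emax 0 hp (by omega) le_rfl (by simp; positivity)
  simpa using this

lemma abs_F_lt {p emax : ℤ} {x : ℝ} (h : x ∈ F p emax) :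
    ∃ (e k : ℤ), 1 - emax ≤ e ∧ e ≤ emax ∧ |(k : ℝ)| ≤ 2 ^ p - 1 ∧
      x = k * (2 : ℝ) ^ (e + 1 - p) := by
  obtain ⟨s, e, M, hs, h1, h2, h3, h4, rfl⟩ := h
  rcases hs with rfl | rfl
  · exact ⟨e, M, h1, h2, by rwa [abs_of_nonneg h3], by ring⟩
  · exact ⟨e, -M, h1, h2, by push_cast; rwa [abs_neg, abs_of_nonneg h3], by push_cast; ring⟩

lemma fmax_eq (p emax : ℤ) :
    fmax p emax = ((2 : ℝ) ^ p - 1) * (2 : ℝ) ^ (emax + 1 - p) := by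
  unfold fmax
  have h1 : (2 : ℝ) ^ (emax + 1 - p) = (2 : ℝ) ^ emax * (2 : ℝ) ^ (1 - p) := by
    rw [← zpow_add₀ (by norm_num)]; congr 1; ring
  have h2 : (2 : ℝ) ^ p * (2 : ℝ) ^ (1 - p) = 2 := by
    rw [← zpow_add₀ (by norm_num)]; simp
  rw [h1]
  linear_combination (-(2 : ℝ) ^ emax) * h2

lemma fmax_mem (p emax : ℤ) (hp : 2 ≤ p) (he : 1 ≤ emax) : fmax p emax ∈ F p emax := by
  obtain ⟨n, rfl⟩ : ∃ n : ℕ, p = n := ⟨p.toNat, by omega⟩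
  have h1 : (1 : ℝ) ≤ 2 ^ n := one_le_pow₀ (by norm_num)
  refine ⟨1, emax, 2 ^ n - 1, Or.inl rfl, by omega, le_rfl, ?_, ?_, ?_⟩
  · push_cast; linarith
  · push_cast; simp
  · rw [fmax_eq]; push_cast; simp

lemma four_le (p : ℤ) (hp : 2 ≤ p) : (4 : ℝ) ≤ 2 ^ p := by
  have : (2 : ℝ) ^ (2 : ℤ) ≤ 2 ^ p := zpow_le_zpow_right₀ (by norm_num) hp
  norm_num at this
  exact this

/-- Every float is at most `fmax`, and the others are at least one ulp below. -/
lemma F_le (p emax : ℤ) (hp : 2 ≤ p) {x : ℝ} (h : x ∈ F p emax) :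
    x = fmax p emax ∨ x ≤ fmax p emax - (2 : ℝ) ^ (emax + 1 - p) := by
  obtain ⟨e, k, h1, h2, h3, rfl⟩ := abs_F_lt h
  have h4 := four_le p hp
  have hk : (k : ℝ) ≤ 2 ^ p - 1 := (le_abs_self _).trans h3
  have hu : (0 : ℝ) < 2 ^ (emax + 1 - p) := by positivity
  rw [fmax_eq]
  rcases eq_or_lt_of_le h2 with rfl | h2
  · rcases eq_or_lt_of_le hk with hk | hk
    · left; rw [hk]
    · right
      obtain ⟨n, rfl⟩ : ∃ n : ℕ, p = n := ⟨p.toNat, by omega⟩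
      have h5 : k < 2 ^ n - 1 := by
        have : (k : ℝ) < ((2 ^ n - 1 : ℤ) : ℝ) := by push_cast; simpa using hk
        exact_mod_cast this
      have h6 : k ≤ 2 ^ n - 2 := by omega
      have h7 : (k : ℝ) ≤ ((2 ^ n - 2 : ℤ) : ℝ) := by exact_mod_cast h6
      push_cast at h7
      rw [zpow_natCast]
      nlinarith
  · right
    have h5 : (2 : ℝ) ^ (e + 1 - p) ≤ 2 ^ (emax - p) :=
      zpow_le_zpow_right₀ (by norm_num) (by omega)
    have h6 : (2 : ℝ) ^ (emax + 1 - p) = 2 * 2 ^ (emax - p) := by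
      rw [show emax + 1 - p = 1 + (emax - p) by ring, zpow_add₀ (by norm_num)]; simp
    have hv : (0 : ℝ) < 2 ^ (emax - p) := by positivity
    have h8 : (k : ℝ) * 2 ^ (e + 1 - p) ≤ (2 ^ p - 1) * 2 ^ (emax - p) :=
      calc (k : ℝ) * 2 ^ (e + 1 - p) ≤ (2 ^ p - 1) * 2 ^ (e + 1 - p) := by gcongr
        _ ≤ _ := by gcongr; linarith
    rw [h6]
    nlinarith

/-- Canonical representation of a nonzero float. -/
lemma canon (p emax : ℤ) {x : ℝ} (h : x ∈ F p emax) (hx : x ≠ 0) :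
    ∃ e k : ℤ, 1 - emax ≤ e ∧ e ≤ emax ∧ e = max (1 - emax) (Int.log 2 |x|) ∧
      x = k * (2 : ℝ) ^ (e + 1 - p) ∧ |(k : ℝ)| < 2 ^ p ∧
      (e = 1 - emax ∨ (2 : ℝ) ^ (p - 1) ≤ |(k : ℝ)|) := by
  obtain ⟨e', M, h1, h2, h3, hxe⟩ := abs_F_lt h
  have hx0 : 0 < |x| := abs_pos.2 hx
  have habs : |x| < (2 : ℝ) ^ (e' + 1) := by
    have : (2 : ℝ) ^ (e' + 1) = 2 ^ p * 2 ^ (e' + 1 - p) := by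
      rw [← zpow_add₀ (by norm_num)]; congr 1; ring
    rw [this, hxe, abs_mul, abs_of_pos (show (0 : ℝ) < 2 ^ (e' + 1 - p) by positivity)]
    gcongr
    linarith
  have hlog1 : (2 : ℝ) ^ (Int.log 2 |x|) ≤ |x| := by
    have := Int.zpow_log_le_self (R := ℝ) (b := 2) (by norm_num) hx0
    simpa using this
  have hlog2 : |x| < (2 : ℝ) ^ (Int.log 2 |x| + 1) := by
    have := Int.lt_zpow_succ_log_self (R := ℝ) (b := 2) (by norm_num) |x|
    simpa using this
  have hle : Int.log 2 |x| ≤ e' := by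
    have : (2 : ℝ) ^ (Int.log 2 |x|) < 2 ^ (e' + 1) := hlog1.trans_lt habs
    have := (zpow_lt_zpow_iff_right₀ (by norm_num : (1 : ℝ) < 2)).1 this
    omega
  obtain ⟨e, hee⟩ : ∃ e, e = max (1 - emax) (Int.log 2 |x|) := ⟨_, rfl⟩
  obtain ⟨d, hd⟩ : ∃ d : ℕ, e' = e + d := ⟨(e' - e).toNat, by omega⟩
  have hxk : x = ((M * 2 ^ d : ℤ) : ℝ) * (2 : ℝ) ^ (e + 1 - p) := by
    rw [hxe, hd, show e + d + 1 - p = d + (e + 1 - p) by ring, zpow_add₀ (by norm_num)]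
    push_cast
    rw [zpow_natCast]; ring
  have hu : (0 : ℝ) < 2 ^ (e + 1 - p) := by positivity
  have hxa : |x| = |((M * 2 ^ d : ℤ) : ℝ)| * (2 : ℝ) ^ (e + 1 - p) := by
    conv_lhs => rw [hxk]
    rw [abs_mul, abs_of_pos hu]
  refine ⟨e, M * 2 ^ d, by omega, by omega, hee, hxk, ?_, ?_⟩
  · have : |x| < 2 ^ p * 2 ^ (e + 1 - p) := by
      rw [← zpow_add₀ (by norm_num)]
      exact hlog2.trans_le (zpow_le_zpow_right₀ (by norm_num) (by omega))
    rw [hxa] at this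
    exact lt_of_mul_lt_mul_right this hu.le
  · by_cases hc : e = 1 - emax
    · exact Or.inl hc
    · right
      have hel : e = Int.log 2 |x| := by omega
      have : (2 : ℝ) ^ (p - 1) * 2 ^ (e + 1 - p) ≤ |x| := by
        rw [← zpow_add₀ (by norm_num), show p - 1 + (e + 1 - p) = e by ring, hel]
        exact hlog1
      rw [hxa] at this
      exact le_of_mul_le_mul_right this hu

/-- Auxiliary: an odd float of larger exponent is separated from any smaller one. -/
lemma sep (p emax : ℤ) (hp : 2 ≤ p) {e f l : ℤ} {x : ℝ} (hef : e < f)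
    (hf1 : 1 - emax ≤ f) (hf2 : f ≤ emax) (hx : |x| < 2 ^ (e + 1))
    (hl : |(l : ℝ)| < 2 ^ p) (hl2 : (2 : ℝ) ^ (p - 1) ≤ |(l : ℝ)|) (hodd : Odd l)
    (hlt : x < l * (2 : ℝ) ^ (f + 1 - p)) :
    ∃ y ∈ F p emax, x < y ∧ y < l * (2 : ℝ) ^ (f + 1 - p) := by
  have hu : (0 : ℝ) < 2 ^ (f + 1 - p) := by positivity
  have hx' : |x| < 2 ^ (p - 1) * 2 ^ (f + 1 - p) := by
    rw [← zpow_add₀ (by norm_num)]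
    exact hx.trans_le (zpow_le_zpow_right₀ (by norm_num) (by omega))
  have hP : (0 : ℝ) < 2 ^ (p - 1) := by positivity
  have hl0 : 0 ≤ (l : ℝ) := by
    by_contra hneg
    push Not at hneg
    rw [abs_of_neg hneg] at hl2
    have h1 := (abs_lt.1 hx').1
    nlinarith
  rw [abs_of_nonneg hl0] at hl hl2
  obtain ⟨n, hn⟩ : ∃ n : ℕ, p = n + 2 := ⟨(p - 2).toNat, by omega⟩
  have hpn : (2 : ℝ) ^ (p - 1) = ((2 * 2 ^ n : ℤ) : ℝ) := by
    rw [hn, show (n : ℤ) + 2 - 1 = 1 + n by ring, zpow_add₀ (by norm_num)]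
    push_cast; simp
  have hl3 : (2 * 2 ^ n : ℤ) ≤ l - 1 := by
    rw [hpn] at hl2
    have h1 : (2 * 2 ^ n : ℤ) ≤ l := by exact_mod_cast hl2
    obtain ⟨m, hm⟩ := hodd
    omega
  have hl4 : (2 : ℝ) ^ (p - 1) ≤ ((l - 1 : ℤ) : ℝ) := by
    rw [hpn]; exact_mod_cast hl3
  refine ⟨((l - 1 : ℤ) : ℝ) * 2 ^ (f + 1 - p), mem_F_of p emax f (l - 1) hp hf1 hf2 ?_, ?_, ?_⟩
  · rw [abs_of_nonneg (hP.le.trans hl4)]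
    push_cast; linarith
  · calc x ≤ |x| := le_abs_self x
      _ < _ := hx'
      _ ≤ _ := by gcongr
  · gcongr
    push_cast; linarith

lemma odd_of {p emax e k : ℤ} {x : ℝ} (hx : ¬ FEven p emax x)
    (he : e = max (1 - emax) (Int.log 2 |x|)) (hk : x = k * (2 : ℝ) ^ (e + 1 - p)) : Odd k := by
  by_contra hc
  exact hx (Or.inr ⟨k, Int.not_odd_iff_even.1 hc, by rw [← he]; exact hk⟩)

lemma abs_lt_of {p e k : ℤ} (hk : |(k : ℝ)| < 2 ^ p) :
    |(k : ℝ) * (2 : ℝ) ^ (e + 1 - p)| < 2 ^ (e + 1) := by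
  have hu : (0 : ℝ) < 2 ^ (e + 1 - p) := by positivity
  have : (2 : ℝ) ^ (e + 1) = 2 ^ p * 2 ^ (e + 1 - p) := by
    rw [← zpow_add₀ (by norm_num)]; congr 1; ring
  rw [this, abs_mul, abs_of_pos hu]
  gcongr

/-- Between two distinct odd floats there is another float. -/
lemma between (p emax : ℤ) (hp : 2 ≤ p) {x s : ℝ} (hx : x ∈ F p emax) (hs : s ∈ F p emax)
    (hxo : ¬ FEven p emax x) (hso : ¬ FEven p emax s) (hlt : x < s) :
    ∃ y ∈ F p emax, x < y ∧ y < s := by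
  obtain ⟨e, k, he1, he2, he3, hxk, hk1, hk2⟩ := canon p emax hx (fun h => hxo (Or.inl h))
  obtain ⟨f, l, hf1, hf2, hf3, hsl, hl1, hl2⟩ := canon p emax hs (fun h => hso (Or.inl h))
  have hko := odd_of hxo he3 hxk
  have hlo := odd_of hso hf3 hsl
  have hxa : |x| < 2 ^ (e + 1) := by rw [hxk]; exact abs_lt_of hk1
  have hsa : |s| < 2 ^ (f + 1) := by rw [hsl]; exact abs_lt_of hl1
  rcases lt_trichotomy e f with hef | hef | hef
  · have := sep p emax hp hef hf1 hf2 hxa hl1 (hl2.resolve_left (by omega)) hlo (by rwa [← hsl])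
    rwa [← hsl] at this
  · subst hef
    have hu : (0 : ℝ) < 2 ^ (e + 1 - p) := by positivity
    have hkl : k < l := by
      rw [hxk, hsl] at hlt
      exact_mod_cast lt_of_mul_lt_mul_right hlt hu.le
    have hkl2 : k + 1 < l := by
      obtain ⟨a, ha⟩ := hko
      obtain ⟨b, hb⟩ := hlo
      omega
    have hkl3 : (k : ℝ) + 1 < l := by exact_mod_cast hkl2
    refine ⟨((k + 1 : ℤ) : ℝ) * 2 ^ (e + 1 - p), mem_F_of p emax e (k + 1) hp he1 he2 ?_, ?_, ?_⟩
    · rw [abs_lt] at *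
      push_cast
      constructor <;> linarith [hk1.1, hl1.2]
    · rw [hxk]; gcongr; push_cast; linarith
    · rw [hsl]; gcongr
  · have h1 : -x = ((-k : ℤ) : ℝ) * 2 ^ (e + 1 - p) := by rw [hxk]; push_cast; ring
    obtain ⟨y, hy, hy1, hy2⟩ := sep p emax hp (l := -k) (x := -s) hef he1 he2 (by rwa [abs_neg])
      (by push_cast; rwa [abs_neg])
      (by push_cast; rw [abs_neg]; exact hk2.resolve_left (by omega)) hko.neg
      (by rw [← h1]; linarith)
    rw [← h1] at hy2
    exact ⟨-y, F_neg hy, by linarith, by linarith⟩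

lemma FEven_neg {p emax : ℤ} {x : ℝ} (h : FEven p emax x) : FEven p emax (-x) := by
  rcases h with h | ⟨k, hk, h⟩
  · left; linarith
  · refine Or.inr ⟨-k, hk.neg, ?_⟩
    rw [abs_neg]
    push_cast
    linarith

lemma nearestSet_neg {p emax : ℤ} {r x : ℝ} (h : x ∈ nearestSet p emax r) :
    -x ∈ nearestSet p emax (-r) := by
  refine ⟨F_neg h.1, fun w hw => ?_⟩
  have := h.2 (-w) (F_neg hw)
  rw [show -r - -x = -(r - x) by ring, show -r - w = -(r - -w) by ring, abs_neg, abs_neg]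
  exact this

lemma fsucc_neg (p emax : ℤ) (x : ℝ) : fsucc p emax (-x) = - fpred p emax x := by
  unfold fsucc fpred
  rw [← Real.sInf_neg]
  congr 1
  ext y
  simp only [Set.mem_setOf_eq, Set.mem_neg]
  constructor
  · rintro ⟨h1, h2⟩; exact ⟨F_neg h1, by linarith⟩
  · rintro ⟨h1, h2⟩; exact ⟨by simpa using F_neg h1, by linarith⟩

lemma nablaNp_neg (p emax : ℤ) (x : ℝ) : nablaNp p emax (-x) = - nablaNm p emax x := by
  have h1 := fsucc_neg p emax x
  have h2 := fsucc_neg p emax (-x)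
  rw [neg_neg] at h2
  unfold nablaNp nablaNm
  have : (-x = fmax p emax) ↔ (x = - fmax p emax) := by
    constructor <;> intro h <;> linarith
  by_cases h : x = - fmax p emax
  · rw [if_pos h, if_pos (this.2 h)]; linarith
  · rw [if_neg h, if_neg (fun h' => h (this.1 h'))]; linarith

lemma upper (p emax : ℤ) (hp : 2 ≤ p) (he : 1 ≤ emax) {r x : ℝ}
    (hb : r < (2 : ℝ) ^ emax * (2 - (2 : ℝ) ^ (-p)))
    (hx : x ∈ nearestSet p emax r)
    (hev : ¬ FEven p emax x → ∀ z ∈ nearestSet p emax r, ¬ FEven p emax z) :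
    r - x ≤ nablaNp p emax x / 2 ∧ (¬ FEven p emax x → r - x < nablaNp p emax x / 2) := by
  unfold nablaNp
  split_ifs with hm
  · suffices r - x < (x - fpred p emax x) / 2 from ⟨this.le, fun _ => this⟩
    have hpred : fpred p emax x ≤ x - 2 ^ (emax + 1 - p) := by
      apply csSup_le
      · refine ⟨0, F_zero p emax hp he, ?_⟩
        rw [hm, fmax_eq]
        have := four_le p hp
        apply mul_pos (by linarith)
        positivity
      · rintro y ⟨hy, hyx⟩
        rcases F_le p emax hp hy with h | h
        · exact absurd (h.trans hm.symm) hyx.ne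
        · rwa [hm]
    have h1 : (2 : ℝ) ^ (emax + 1 - p) = 2 ^ emax * (2 * 2 ^ (-p)) := by
      rw [show emax + 1 - p = emax + (1 + -p) by ring, zpow_add₀ (by norm_num),
        zpow_add₀ (by norm_num)]
      simp
    have h2 : x = (2 : ℝ) ^ emax * (2 - 2 * 2 ^ (-p)) := by
      rw [hm]; unfold fmax
      rw [show 1 - p = 1 + -p by ring, zpow_add₀ (by norm_num)]
      simp
    rw [h1] at hpred
    linarith
  · have hlt : x < fmax p emax := by
      rcases F_le p emax hp hx.1 with h | h
      · exact absurd h hm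
      · have : (0 : ℝ) < 2 ^ (emax + 1 - p) := by positivity
        linarith
    have hfin : {y | y ∈ F p emax ∧ x < y}.Finite := (F_finite p emax).subset fun y hy => hy.1
    have hs : fsucc p emax x ∈ {y | y ∈ F p emax ∧ x < y} :=
      Set.Nonempty.csInf_mem ⟨_, fmax_mem p emax hp he, hlt⟩ hfin
    have hmin : ∀ y ∈ F p emax, x < y → fsucc p emax x ≤ y := fun y hy hxy =>
      csInf_le hfin.bddBelow ⟨hy, hxy⟩
    generalize fsucc p emax x = s at *
    obtain ⟨hsF, hxs⟩ := hs
    have hle : r - x ≤ (s - x) / 2 := by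
      have h := hx.2 s hsF
      by_contra hc
      push Not at hc
      rw [abs_of_pos (by linarith)] at h
      have : |r - s| < r - x := by rw [abs_lt]; constructor <;> linarith
      linarith
    refine ⟨hle, fun hodd => lt_of_le_of_ne hle fun heq => ?_⟩
    have hsn : s ∈ nearestSet p emax r := by
      refine ⟨hsF, fun w hw => ?_⟩
      have : |r - s| = |r - x| := by
        rw [show r - s = -(r - x) by linarith, abs_neg]
      rw [this]
      exact hx.2 w hw
    obtain ⟨y, hy, h1, h2⟩ := between p emax hp hx.1 hsF hodd (hev hodd s hsn) hxs
    linarith [hmin y hy h1]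

lemma nearest_spec (p emax : ℤ) (hp : 2 ≤ p) (he : 1 ≤ emax) (r : ℝ) :
    nearest p emax r ∈ nearestSet p emax r ∧
      (¬ FEven p emax (nearest p emax r) → ∀ z ∈ nearestSet p emax r, ¬ FEven p emax z) := by
  have hex : ∃ z, z ∈ nearestSet p emax r := by
    obtain ⟨z, hz, hmin⟩ := Set.exists_min_image (F p emax) (fun z => |r - z|) (F_finite p emax)
      ⟨0, F_zero p emax hp he⟩
    exact ⟨z, hz, hmin⟩
  unfold nearest
  split_ifs with h
  · exact ⟨h.choose_spec.1, fun hc => absurd h.choose_spec.2 hc⟩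
  · exact ⟨hex.choose_spec, fun _ z hz hze => h ⟨z, hz, hze⟩⟩

end FPVerif

open FPVerif

/-- Let `r` be a nonzero real with `|r| < 2^emax·(2 − 2^(−p))`, so that
`x := [r]n` is an element of `𝔽`.  Then `∇2n−(x)/2 ≤ r − x ≤ ∇2n+(x)/2`, and
both inequalities are strict whenever `x` is odd. -/
theorem rndNear_error (p emax : ℤ) (hp : 2 ≤ p) (he : 1 ≤ emax)
    (r : ℝ) (hr : r ≠ 0)
    (hb : |r| < (2 : ℝ) ^ emax * (2 - (2 : ℝ) ^ (-p))) :
    ∃ x : ℝ, rndNear p emax r = (x : EReal) ∧ x ∈ F p emax ∧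
      nablaNm p emax x / 2 ≤ r - x ∧ r - x ≤ nablaNp p emax x / 2 ∧
      (¬ FEven p emax x →
        nablaNm p emax x / 2 < r - x ∧ r - x < nablaNp p emax x / 2) := by
  obtain ⟨hx, hev⟩ := nearest_spec p emax hp he r
  have hb' := abs_lt.1 hb
  have hup := upper p emax hp he hb'.2 hx hev
  have hdn := upper p emax hp he (r := -r) (by linarith [hb'.1]) (nearestSet_neg hx)
    (fun h z hz hze => hev (fun h' => h (FEven_neg h')) (-z)
      (by simpa using nearestSet_neg hz) (FEven_neg hze))
  rw [nablaNp_neg] at hdn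
  refine ⟨nearest p emax r, ?_, hx.1, by linarith [hdn.1], hup.1, fun h => ⟨?_, hup.2 h⟩⟩
  · unfold rndNear
    rw [if_neg (not_le.2 hb'.2), if_neg (not_le.2 hb'.1)]
  · have := hdn.2 (fun h' => h (by simpa using FEven_neg h'))
    linarith
end
end

section
/- Let xl, xu ∈ 𝔽 with xl ≤ xu. Then the minimum of x + ∇2n−(x)/2 over all x ∈ 𝔽 with xl ≤ x ≤ xu is attained at xl; that is, for every x ∈ 𝔽 with xl ≤ x ≤ xu one has xl + ∇2n−(xl)/2 ≤ x + ∇2n−(x)/2. -/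
noncomputable section

open scoped Classical

open FPVerif

theorem fmax_eq_aux (p emax : ℤ) :
    fmax p emax = ((2 : ℝ) ^ p - 1) * (2 : ℝ) ^ (emax + 1 - p) := by
  have h2 : (2 : ℝ) ≠ 0 := by norm_num
  unfold fmax
  rw [show emax + 1 - p = emax + (1 - p) by ring, zpow_add₀ h2 emax (1 - p),
    zpow_sub₀ h2 1 p]
  have : (2 : ℝ) ^ p ≠ 0 := zpow_ne_zero _ h2
  field_simp

theorem neg_fmax_mem_aux (p emax : ℤ) (hp : 2 ≤ p) (he : 1 ≤ emax) :
    -fmax p emax ∈ F p emax := by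
  lift p to ℕ using by omega
  have h1 : (1 : ℝ) ≤ 2 ^ p := one_le_pow₀ (by norm_num)
  refine ⟨-1, emax, 2 ^ p - 1, Or.inr rfl, by omega, le_refl _, ?_, ?_, ?_⟩
  · push_cast
    linarith
  · push_cast
    rw [zpow_natCast]
  · rw [fmax_eq_aux, zpow_natCast]
    push_cast
    ring

theorem neg_fmax_le_aux (p emax : ℤ) {y : ℝ} (hy : y ∈ F p emax) :
    -fmax p emax ≤ y := by
  obtain ⟨s, e, M, hs, _, he, hM0, hM, rfl⟩ := hy
  rw [fmax_eq_aux]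
  have h1 : (2 : ℝ) ^ (e + 1 - p) ≤ 2 ^ (emax + 1 - p) :=
    zpow_le_zpow_right₀ (by norm_num) (by omega)
  have h0 : (0 : ℝ) < 2 ^ (e + 1 - p) := by positivity
  have h3 : (M : ℝ) * 2 ^ (e + 1 - p) ≤ ((2 : ℝ) ^ p - 1) * 2 ^ (emax + 1 - p) :=
    mul_le_mul hM h1 h0.le (hM0.trans hM)
  have h4 : 0 ≤ (M : ℝ) * 2 ^ (e + 1 - p) := mul_nonneg hM0 h0.le
  rcases hs with rfl | rfl <;> linarith

/-- The minimum of `x + ∇2n−(x)/2` over floats `x` with `xl ≤ x ≤ xu` is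
attained at `xl`. -/
theorem min_add_half_nablaNm (p emax : ℤ) (hp : 2 ≤ p) (he : 1 ≤ emax)
    (xl xu : ℝ) (hxl : xl ∈ F p emax) (hxu : xu ∈ F p emax) (hle : xl ≤ xu) :
    ∀ x ∈ F p emax, xl ≤ x → x ≤ xu →
      xl + nablaNm p emax xl / 2 ≤ x + nablaNm p emax x / 2 := by
  intro x hx hlx _
  rcases hlx.eq_or_lt with rfl | hlt
  · exact le_rfl
  have hxne : x ≠ -fmax p emax := ((neg_fmax_le_aux p emax hxl).trans_lt hlt).ne'
  have hpx : xl ≤ fpred p emax x :=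
    le_csSup ⟨x, fun y hy => hy.2.le⟩ ⟨hxl, hlt⟩
  have hl : nablaNm p emax xl ≤ 0 := by
    unfold nablaNm
    split_ifs with h
    · have : xl ≤ fsucc p emax xl := le_csInf ⟨x, hx, hlt⟩ fun y hy => hy.2.le
      linarith
    · have : fpred p emax xl ≤ xl :=
        csSup_le ⟨_, neg_fmax_mem_aux p emax hp he,
          lt_of_le_of_ne (neg_fmax_le_aux p emax hxl) (Ne.symm h)⟩ fun y hy => hy.2.le
      linarith
  have hr : nablaNm p emax x = fpred p emax x - x := if_neg hxne
  rw [hr]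
  linarith
end
end

section
/- Let x, z ∈ 𝔽 with x > −fmax and x − pred(x) = fmin (i.e., the round-to-nearest error bound |∇2n−(x)| at x equals fmin). Then [x − fmin/2 − z]↑ = [x − z]↑ as extended reals; in other words, subtracting the half-ulp fmin/2 does not change the result of rounding x − z toward +∞. -/
noncomputable section

open scoped Classical

open FPVerif

/-- Every float is an integer multiple of `fmin`. -/
theorem F_mul_fmin (p emax : ℤ) (x : ℝ) (hx : x ∈ F p emax) :
    ∃ k : ℤ, x = (k : ℝ) * fmin p emax := by
  obtain ⟨s, e, M, hs, h1, _, _, _, rfl⟩ := hx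
  obtain ⟨n, hn⟩ := Int.eq_ofNat_of_zero_le (sub_nonneg.mpr h1)
  have h : (2 : ℝ) ^ (e + 1 - p) = 2 ^ n * fmin p emax := by
    unfold fmin
    rw [← zpow_natCast, ← zpow_add₀ (by norm_num)]
    congr 1
    omega
  rcases hs with rfl | rfl
  · exact ⟨M * 2 ^ n, by rw [h]; push_cast; ring⟩
  · exact ⟨-(M * 2 ^ n), by rw [h]; push_cast; ring⟩

/-- The largest float is a float. -/
theorem fmax_mem_F (p emax : ℤ) (hp : 2 ≤ p) (he : 1 ≤ emax) :
    fmax p emax ∈ F p emax := by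
  obtain ⟨n, rfl⟩ := Int.eq_ofNat_of_zero_le (show 0 ≤ p by omega)
  have h1 : (1 : ℝ) ≤ 2 ^ n := one_le_pow₀ (by norm_num)
  refine ⟨1, emax, 2 ^ n - 1, Or.inl rfl, by omega, le_rfl, ?_, ?_, ?_⟩
  · push_cast; linarith
  · push_cast; simp
  · unfold fmax
    have h2 : (2 : ℝ) ^ n ≠ 0 := by positivity
    rw [zpow_sub₀ (by norm_num), zpow_sub₀ (by norm_num), zpow_add₀ (by norm_num)]
    push_cast
    simp only [zpow_natCast, zpow_one]
    field_simp

/-- If `x, z ∈ 𝔽`, `x > −fmax` and `x − pred(x) = fmin`, then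
`[x − fmin/2 − z]↑ = [x − z]↑` as extended reals. -/
theorem rndUp_sub_half_ulp (p emax : ℤ) (hp : 2 ≤ p) (he : 1 ≤ emax)
    (x z : ℝ) (hx : x ∈ F p emax) (hz : z ∈ F p emax)
    (hxgt : -fmax p emax < x)
    (hulp : x - fpred p emax x = fmin p emax) :
    rndUp p emax (x - fmin p emax / 2 - z) = rndUp p emax (x - z) := by
  have hf : 0 < fmin p emax := by unfold fmin; positivity
  obtain ⟨a, ha⟩ := F_mul_fmin p emax x hx
  obtain ⟨b, hb⟩ := F_mul_fmin p emax z hz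
  have key : ∀ w ∈ F p emax, (x - fmin p emax / 2 - z ≤ w ↔ x - z ≤ w) := by
    intro w hw
    obtain ⟨m, hm⟩ := F_mul_fmin p emax w hw
    refine ⟨fun h => ?_, fun h => by linarith⟩
    have h3 : ((a : ℝ) - b - m - 1 / 2) * fmin p emax ≤ 0 := by
      rw [ha, hb, hm] at h; linarith
    have h4 : (a : ℝ) - b - m - 1 / 2 ≤ 0 := by
      by_contra hc
      exact absurd h3 (not_le.mpr (mul_pos (not_le.mp hc) hf))
    have h5 : a - b - m < 1 := by
      have : ((a - b - m : ℤ) : ℝ) < (1 : ℤ) := by push_cast; linarith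
      exact_mod_cast this
    have h6 : ((a - b - m : ℤ) : ℝ) ≤ (0 : ℤ) := by
      exact_mod_cast (show a - b - m ≤ 0 by omega)
    push_cast at h6
    have := mul_nonneg (sub_nonneg.mpr h6) hf.le
    rw [ha, hb, hm]; linarith
  have hs : {w | w ∈ F p emax ∧ x - fmin p emax / 2 - z ≤ w} =
      {w | w ∈ F p emax ∧ x - z ≤ w} := by
    ext w
    exact and_congr_right (key w)
  have hm := key _ (fmax_mem_F p emax hp he)
  unfold rndUp
  rw [hs]
  by_cases h : fmax p emax < x - z
  · rw [if_pos h, if_pos (not_le.mp fun h' => absurd (hm.mp h') (not_le.mpr h))]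
  · rw [if_neg h, if_neg (not_lt.mpr (hm.mpr (not_lt.mp h)))]
end
end
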